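/- arXiv:1011.0228 — 4 statements merged into one kernel-verified Lean document; each statement's English description precedes it below -/
import Mathlib

section
/- Let a₀, a₁, a₂ be real numbers and define S = { x ∈ ℝ : a₀·exp(−(x+1/2)²/2) + a₁·exp(−x²/2) + a₂·exp(−(x−1/2)²/2) > 0 }. Then either S is order-connected (i.e., an interval of ℝ, possibly empty, a half-line, or all of ℝ) or its complement ℝ \ S is order-connected. -/
theorem ulq_pos_iff (a₀ a₁ a₂ x : ℝ) :
    0 < a₀ * Real.exp (-(x + 1/2)^2 / 2) + a₁ * Real.exp (-x^2 / 2)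
        + a₂ * Real.exp (-(x - 1/2)^2 / 2) ↔
    0 < a₀ + a₁ * Real.exp (1/8) * Real.exp (x/2) + a₂ * Real.exp (x/2) ^ 2 := by
  have h1 : Real.exp (-x^2 / 2) =
      Real.exp (-(x + 1/2)^2 / 2) * (Real.exp (1/8) * Real.exp (x/2)) := by
    rw [← Real.exp_add, ← Real.exp_add]; congr 1; ring
  have h2 : Real.exp (-(x - 1/2)^2 / 2) =
      Real.exp (-(x + 1/2)^2 / 2) * Real.exp (x/2) ^ 2 := by
    rw [pow_two (Real.exp (x/2)), ← Real.exp_add, ← Real.exp_add]; congr 1; ring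
  have h3 := Real.exp_pos (-(x + 1/2)^2 / 2)
  rw [h1, h2]
  generalize Real.exp (-(x + 1/2)^2 / 2) = c at h3 ⊢
  rw [← mul_pos_iff_of_pos_left (a := c) h3
    (b := a₀ + a₁ * Real.exp (1/8) * Real.exp (x/2) + a₂ * Real.exp (x/2) ^ 2)]
  ring_nf

theorem ulq_identity (A B C r s u : ℝ) :
    (u - r) * (A + B * s + C * s ^ 2) = (u - s) * (A + B * r + C * r ^ 2)
      + (s - r) * (A + B * u + C * u ^ 2) - C * ((u - s) * (s - r) * (u - r)) := by
  ring

/-- Lemma 6.1 (symmetric case HT2): for the three unit-variance normal densities with means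
`-1/2, 0, 1/2`, the positivity set of any linear combination of the densities, or its
complement, is order-connected (i.e. an interval of `ℝ`). -/
theorem ULQ_positivity_set_or_complement_is_interval (a₀ a₁ a₂ : ℝ) :
    ({x : ℝ | 0 < a₀ * Real.exp (-(x + 1/2)^2 / 2) + a₁ * Real.exp (-x^2 / 2)
        + a₂ * Real.exp (-(x - 1/2)^2 / 2)}).OrdConnected ∨
    ({x : ℝ | 0 < a₀ * Real.exp (-(x + 1/2)^2 / 2) + a₁ * Real.exp (-x^2 / 2)
        + a₂ * Real.exp (-(x - 1/2)^2 / 2)}ᶜ).OrdConnected := by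
  simp only [ulq_pos_iff]
  generalize a₁ * Real.exp (1/8) = B
  rcases le_total a₂ 0 with hC | hC
  · left
    refine ⟨fun x hx y hy z hz => ?_⟩
    simp only [Set.mem_ofPred_eq] at hx hy ⊢
    rcases hz.1.eq_or_lt with h | h
    · rwa [← h]
    have h1 : Real.exp (x/2) < Real.exp (z/2) := Real.exp_lt_exp.2 (by linarith)
    have h2 : Real.exp (z/2) ≤ Real.exp (y/2) := Real.exp_le_exp.2 (by linarith [hz.2])
    have key := ulq_identity a₀ B a₂ (Real.exp (x/2)) (Real.exp (z/2)) (Real.exp (y/2))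
    have e1 := mul_nonneg (sub_nonneg.2 h2) hx.le
    have e2 := mul_pos (sub_pos.2 h1) hy
    have e3 := mul_nonpos_of_nonpos_of_nonneg hC
      (mul_nonneg (mul_nonneg (sub_nonneg.2 h2) (sub_nonneg.2 h1.le))
        (sub_nonneg.2 (h1.le.trans h2)))
    refine pos_of_mul_pos_right (a := Real.exp (y/2) - Real.exp (x/2)) ?_ (by linarith)
    linarith
  · right
    refine ⟨fun x hx y hy z hz => ?_⟩
    simp only [Set.mem_compl_iff, Set.mem_ofPred_eq, not_lt] at hx hy ⊢
    rcases hz.1.eq_or_lt with h | h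
    · rwa [← h]
    have h1 : Real.exp (x/2) < Real.exp (z/2) := Real.exp_lt_exp.2 (by linarith)
    have h2 : Real.exp (z/2) ≤ Real.exp (y/2) := Real.exp_le_exp.2 (by linarith [hz.2])
    have key := ulq_identity a₀ B a₂ (Real.exp (x/2)) (Real.exp (z/2)) (Real.exp (y/2))
    have e1 := mul_nonpos_of_nonneg_of_nonpos (sub_nonneg.2 h2) hx
    have e2 := mul_nonpos_of_nonneg_of_nonpos (sub_nonneg.2 h1.le) hy
    have e3 := mul_nonneg hC
      (mul_nonneg (mul_nonneg (sub_nonneg.2 h2) (sub_nonneg.2 h1.le))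
        (sub_nonneg.2 (h1.le.trans h2)))
    by_contra! hcon
    have e4 := mul_pos (sub_pos.2 (h1.trans_le h2)) hcon
    linarith
end

section
/- Let E be a real vector space of finite dimension d ≥ 1, let S ⊆ E, and let x be a point of the convex hull of S that lies in the topological frontier (boundary) of the convex hull of S. Then there exists a subset T ⊆ S with at most d elements such that x belongs to the convex hull of T. -/
/-- Carathéodory-type theorem for frontier points (Hörmander): a point of the convex hull of
`S` lying on the topological frontier of the convex hull, in a `d`-dimensional real normed
space, is a convex combination of at most `d` points of `S` (one fewer than the `d + 1` points
of the ordinary Carathéodory theorem). -/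
theorem frontier_convexHull_subset_convexHull_card_le
    (E : Type*) [NormedAddCommGroup E] [NormedSpace ℝ E] [FiniteDimensional ℝ E]
    (d : ℕ) (hd : 1 ≤ d) (hdim : Module.finrank ℝ E = d)
    (S : Set E) (x : E)
    (hx : x ∈ convexHull ℝ S) (hxf : x ∈ frontier (convexHull ℝ S)) :
    ∃ T : Finset E, ↑T ⊆ S ∧ T.card ≤ d ∧ x ∈ convexHull ℝ (T : Set E) := by
  classical
  obtain ⟨ι, _, z, w, hzS, hz, hw, hw1, rfl⟩ := eq_pos_convex_span_of_mem_convexHull hx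
  have hmem : ∑ i, w i • z i ∈ convexHull ℝ (Set.range z) :=
    (convex_convexHull ℝ _).sum_mem (fun i _ => (hw i).le) hw1
      (fun i _ => subset_convexHull ℝ _ ⟨i, rfl⟩)
  by_cases hc : Fintype.card ι ≤ d
  · refine ⟨Finset.univ.image z, by simpa using hzS, Finset.card_image_le.trans hc, ?_⟩
    simpa using hmem
  · exfalso
    have hcard : Fintype.card ι = Module.finrank ℝ E + 1 := by
      have h1 := hz.card_le_finrank_succ
      have h2 := Submodule.finrank_le (vectorSpan ℝ (Set.range z))
      omega
    let b : AffineBasis ι ℝ E := ⟨z, hz, hz.affineSpan_eq_top_iff_card_eq_finrank_add_one.mpr hcard⟩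
    have hb : ∀ i, b i = z i := fun i => rfl
    apply hxf.2
    apply interior_mono (convexHull_mono hzS)
    change _ ∈ interior (convexHull ℝ (Set.range b))
    rw [b.interior_convexHull]
    intro i
    have hcomb : ∑ i, w i • z i = Finset.univ.affineCombination ℝ b w := by
      rw [Finset.affineCombination_eq_linear_combination _ _ _ hw1]
      rfl
    rw [hcomb, b.coord_apply_combination_of_mem (Finset.mem_univ i) hw1]
    exact hw i
end

section
/- Let d ≥ 1 and let 𝓘 be a nonempty compact subset of ℝ^d, with K the convex hull of 𝓘 (which is compact). Then there exist points q¹,…,q^d ∈ 𝓘 and weights p₁,…,p_d ≥ 0 with Σ_{j=1}^d p_j = 1 such that the point x* = Σ_{j=1}^d p_j q^j satisfies min_{1≤i≤d} x*_i = max_{x ∈ K} ( min_{1≤i≤d} x_i ); that is, the maximum over K of the minimum-coordinate function h(x) = min_{1≤i≤d} x_i is attained at a convex combination of at most d points of 𝓘. -/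
open scoped BigOperators

theorem mm_dir (d m : ℕ) (hd : 1 ≤ d) (hm : d < m) (z : Fin m → (Fin d → ℝ)) :
    ∃ c : Fin m → ℝ, c ≠ 0 ∧ ∑ j, c j = 0 ∧ ∀ i, 0 ≤ (∑ j, c j • z j) i := by
  let i0 : Fin d := ⟨0, hd⟩
  let A : Matrix (Fin d) (Fin m) ℝ := fun i j => if i = i0 then 1 else z j i - z j i0
  have hlt : Module.finrank ℝ (Fin d → ℝ) < Module.finrank ℝ (Fin m → ℝ) := by simpa using hm
  have hker := LinearMap.ker_ne_bot_of_finrank_lt (f := Matrix.mulVecLin A) hlt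
  obtain ⟨c, hc, hc0⟩ := (Submodule.ne_bot_iff _).mp hker
  have hA : ∀ i, ∑ j, A i j * c j = 0 := fun i => congrFun (LinearMap.mem_ker.mp hc) i
  have hs : ∑ j, c j = 0 := by simpa [A] using hA i0
  have he : ∀ i, (∑ j, c j • z j) i = (∑ j, c j • z j) i0 := by
    intro i
    by_cases hi : i = i0
    · rw [hi]
    · have h := hA i
      simp only [A, if_neg hi, sub_mul, Finset.sum_sub_distrib] at h
      simp only [Finset.sum_apply, Pi.smul_apply, smul_eq_mul]
      simp only [mul_comm (c _)]
      linarith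
  rcases le_total 0 ((∑ j, c j • z j) i0) with h | h
  · exact ⟨c, hc0, hs, fun i => by rw [he]; exact h⟩
  · refine ⟨-c, neg_ne_zero.mpr hc0, by simp [hs], fun i => ?_⟩
    have : (∑ j, (-c) j • z j) = - ∑ j, c j • z j := by simp
    rw [this, Pi.neg_apply, he]
    linarith

theorem mm_reduce (d : ℕ) (hd : 1 ≤ d) (S : Set (Fin d → ℝ)) (n : ℕ) :
    ∀ (z : Fin (d + n) → (Fin d → ℝ)) (w : Fin (d + n) → ℝ), (∀ j, z j ∈ S) → (∀ j, 0 ≤ w j) →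
      ∑ j, w j = 1 → ∃ (q : Fin d → (Fin d → ℝ)) (p : Fin d → ℝ),
      (∀ j, q j ∈ S) ∧ (∀ j, 0 ≤ p j) ∧ (∑ j, p j = 1) ∧
      ∀ i, (∑ j, w j • z j) i ≤ (∑ j, p j • q j) i := by
  induction n with
  | zero => exact fun z w hz hw h1 => ⟨z, w, hz, hw, h1, fun i => le_rfl⟩
  | succ n ih =>
    intro z w hz hw h1
    obtain ⟨c, hc0, hcs, hcz⟩ := mm_dir d (d + (n + 1)) hd (by omega) z
    have hneg : (Finset.univ.filter (fun j => c j < 0)).Nonempty := by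
      by_contra hcon
      have hnn : ∀ j, 0 ≤ c j := by
        intro j
        by_contra hj
        exact hcon ⟨j, by simpa using hj⟩
      apply hc0
      funext j
      exact (Finset.sum_eq_zero_iff_of_nonneg (fun j _ => hnn j)).mp hcs j (Finset.mem_univ j)
    obtain ⟨k, hk, hmin⟩ := Finset.exists_min_image _ (fun j => w j / (-c j)) hneg
    have hk' : c k < 0 := by simpa using hk
    set s := w k / (-c k) with hsdef
    have hs0 : 0 ≤ s := div_nonneg (hw k) (by linarith)
    have hw' : ∀ j, 0 ≤ w j + s * c j := by
      intro j
      by_cases hj : c j < 0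
      · have := hmin j (by simpa using hj)
        rw [le_div_iff₀ (by linarith)] at this
        linarith
      · have := mul_nonneg hs0 (not_lt.mp hj)
        linarith [hw j]
    have hwk : w k + s * c k = 0 := by
      rw [hsdef]
      have := hk'.ne
      field_simp
      ring
    have e1 : ∑ j, (w j + s * c j) = 1 := by
      rw [Finset.sum_add_distrib, ← Finset.mul_sum, hcs, h1]; simp
    have e2 : ∑ j, (w j + s * c j) • z j = ∑ j, w j • z j + s • ∑ j, c j • z j := by
      simp only [add_smul, Finset.sum_add_distrib, Finset.smul_sum, mul_smul]
    let k' : Fin (d + n + 1) := k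
    have f1 := Fin.sum_univ_succAbove (n := d + n) (fun j => w j + s * c j) k'
    have f2 := Fin.sum_univ_succAbove (n := d + n) (fun j => (w j + s * c j) • z j) k'
    have hwk' : w k' + s * c k' = 0 := hwk
    rw [hwk', zero_add] at f1
    rw [hwk', zero_smul, zero_add] at f2
    obtain ⟨q, p, hq, hp, hp1, hle⟩ := ih (fun j => z (k'.succAbove j))
      (fun j => w (k'.succAbove j) + s * c (k'.succAbove j)) (fun j => hz _) (fun j => hw' _)
      (f1.symm.trans e1)
    refine ⟨q, p, hq, hp, hp1, fun i => le_trans ?_ (hle i)⟩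
    have e3 := congrFun (f2.symm.trans e2) i
    rw [e3, Pi.add_apply, Pi.smul_apply, smul_eq_mul]
    have := mul_nonneg hs0 (hcz i)
    linarith

theorem mm_hull (d : ℕ) (hd : 1 ≤ d) (S : Set (Fin d → ℝ)) (x : Fin d → ℝ)
    (hx : x ∈ convexHull ℝ S) : ∃ (q : Fin d → (Fin d → ℝ)) (p : Fin d → ℝ),
      (∀ j, q j ∈ S) ∧ (∀ j, 0 ≤ p j) ∧ (∑ j, p j = 1) ∧
      ∀ i, x i ≤ (∑ j, p j • q j) i := by
  obtain ⟨a, ha⟩ : S.Nonempty := convexHull_nonempty_iff.mp ⟨x, hx⟩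
  obtain ⟨ι, _, z, w, hz, -, hw, h1, hsum⟩ := eq_pos_convex_span_of_mem_convexHull hx
  let e := (Fintype.equivFin ι).symm
  have g1 : ∑ j, w (e j) = 1 := (e.sum_comp w).trans h1
  have g2 : ∑ j, w (e j) • z (e j) = x := (e.sum_comp (fun i => w i • z i)).trans hsum
  obtain ⟨q, p, hq, hp, hp1, hle⟩ := mm_reduce d hd S (Fintype.card ι)
    (Fin.append (fun _ => a) (fun j => z (e j))) (Fin.append (fun _ => 0) (fun j => w (e j)))
    (fun j => by
      refine Fin.addCases (fun j => ?_) (fun j => ?_) j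
      · simpa using ha
      · simpa using hz ⟨_, rfl⟩)
    (fun j => by
      refine Fin.addCases (fun j => ?_) (fun j => ?_) j
      · simp
      · simpa using (hw _).le)
    (by simpa [Fin.sum_univ_add] using g1)
  refine ⟨q, p, hq, hp, hp1, fun i => ?_⟩
  have := hle i
  simp only [Fin.sum_univ_add, Fin.append_left, Fin.append_right, zero_smul,
    Finset.sum_const_zero, zero_add, g2] at this
  exact this

/-- The maximum over the convex hull `K` of a nonempty compact set `𝓘 ⊆ ℝ^d` of the
minimum-coordinate function `h x = min_{1 ≤ i ≤ d} x i` is attained at a convex combination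
of at most `d` points of `𝓘`. -/
theorem maximin_attained_by_randomizing_d_points
    (d : ℕ) (hd : 1 ≤ d) (𝓘 : Set (Fin d → ℝ)) (hne : 𝓘.Nonempty) (hcomp : IsCompact 𝓘) :
    ∃ (q : Fin d → (Fin d → ℝ)) (p : Fin d → ℝ),
      (∀ j, q j ∈ 𝓘) ∧ (∀ j, 0 ≤ p j) ∧ (∑ j, p j = 1) ∧
      IsGreatest
        ((fun x : Fin d → ℝ =>
            Finset.univ.inf' (Finset.univ_nonempty_iff.mpr ⟨⟨0, hd⟩⟩) (fun i => x i)) ''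
          (convexHull ℝ 𝓘))
        (Finset.univ.inf' (Finset.univ_nonempty_iff.mpr ⟨⟨0, hd⟩⟩)
          (fun i => (∑ j, p j • q j) i)) := by
  have hn : (Finset.univ : Finset (Fin d)).Nonempty := Finset.univ_nonempty_iff.mpr ⟨⟨0, hd⟩⟩
  have hC : IsCompact ((stdSimplex ℝ (Fin d)) ×ˢ (Set.univ.pi (fun _ : Fin d => 𝓘))) :=
    (isCompact_stdSimplex ℝ (Fin d)).prod (isCompact_univ_pi (fun _ => hcomp))
  have hcont : Continuous (fun y : (Fin d → ℝ) × (Fin d → (Fin d → ℝ)) =>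
      Finset.univ.inf' hn (fun i => (∑ j, y.1 j • y.2 j) i)) := by
    apply Continuous.finset_inf'_apply
    intro i _
    fun_prop
  obtain ⟨a, ha⟩ := hne
  obtain ⟨⟨p, q⟩, ⟨hp, hq⟩, hmax⟩ := hC.exists_isMaxOn
    (by
      refine ⟨(Pi.single ⟨0, hd⟩ 1, fun _ => a), single_mem_stdSimplex ℝ _, ?_⟩
      intro j _
      exact ha) hcont.continuousOn
  have hq' : ∀ j, q j ∈ 𝓘 := fun j => hq j (Set.mem_univ j)
  refine ⟨q, p, hq', hp.1, hp.2, ⟨_, ?_, rfl⟩, ?_⟩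
  · exact (convex_convexHull ℝ 𝓘).sum_mem (fun j _ => hp.1 j) hp.2
      (fun j _ => subset_convexHull ℝ 𝓘 (hq' j))
  · rintro _ ⟨x, hx, rfl⟩
    obtain ⟨q', p', hq1, hp1, hp2, hle⟩ := mm_hull d hd 𝓘 x hx
    have h := hmax (show (p', q') ∈ _ from ⟨⟨hp1, hp2⟩, fun j _ => hq1 j⟩)
    refine le_trans ?_ h
    apply Finset.le_inf'
    intro i hi
    exact (Finset.inf'_le _ hi).trans (hle i)
end

section
/- Let Φ be a nonempty set (of quantizers at a single sensor), let A be a finite nonempty index set (the states m'' distinct from a fixed state m), and for each m'' ∈ A let g_{m''} : Φ → ℝ (the single-sensor Kullback–Leibler divergence of state m'' from state m). Fix an integer K ≥ 1. A randomized quantizer vector is a finite family of weights p_1,…,p_J ≥ 0 with Σ_j p_j = 1 together with points φ_1,…,φ_J ∈ Φ^K, and its divergence at index m'' is G_{m''}(p,φ) = Σ_{j=1}^J p_j Σ_{k=1}^K g_{m''}(φ_j(k)). Suppose weights q_1,…,q_{J'} ≥ 0 with Σ_j q_j = 1 and points ψ_1,…,ψ_{J'} ∈ Φ form a maximin single-sensor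 randomization, i.e., for all finite weights r and points χ in Φ: min_{m''∈A} Σ_l r_l g_{m''}(χ_l) ≤ min_{m''∈A} Σ_j q_j g_{m''}(ψ_j). Then the K-fold replicate (weights q_j, vectors (ψ_j,…,ψ_j) ∈ Φ^K) is maximin among randomized quantizer vectors: for every randomized quantizer vector (p, φ), min_{m''∈A} G_{m''}(p,φ) ≤ K · min_{m''∈A} Σ_j q_j g_{m''}(ψ_j) = min_{m''∈A} G_{m''}(q, (ψ_j,…,ψ_j)_j). -/
open scoped BigOperators

/-- Proposition 5.1: in a system of `K` conditionally i.i.d. sensors, where the divergence of a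
deterministic quantizer vector is the sum over sensors of the single-sensor divergences and the
divergence of a randomization is the weighted average, the `K`-fold replicate of a maximin
single-sensor randomization is maximin among all randomized quantizer vectors, with maximin
value `K` times the single-sensor maximin value. -/
theorem replicated_maximin_quantizer_vector
    {Φ A : Type*} [Nonempty Φ] [Fintype A] [Nonempty A]
    (g : A → Φ → ℝ) (K : ℕ) (hK : 1 ≤ K)
    (J' : ℕ) (q : Fin J' → ℝ) (ψ : Fin J' → Φ)
    (hq : ∀ j, 0 ≤ q j) (hqs : ∑ j, q j = 1)
    (hmaximin : ∀ (n : ℕ) (r : Fin n → ℝ) (χ : Fin n → Φ),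
      (∀ l, 0 ≤ r l) → (∑ l, r l = 1) →
      Finset.univ.inf' Finset.univ_nonempty (fun m'' : A => ∑ l, r l * g m'' (χ l)) ≤
        Finset.univ.inf' Finset.univ_nonempty (fun m'' : A => ∑ j, q j * g m'' (ψ j))) :
    ((K : ℝ) * Finset.univ.inf' Finset.univ_nonempty
        (fun m'' : A => ∑ j, q j * g m'' (ψ j)) =
      Finset.univ.inf' Finset.univ_nonempty
        (fun m'' : A => ∑ j, q j * ∑ _k : Fin K, g m'' (ψ j))) ∧
    ∀ (J : ℕ) (p : Fin J → ℝ) (φ : Fin J → Fin K → Φ),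
      (∀ j, 0 ≤ p j) → (∑ j, p j = 1) →
      Finset.univ.inf' Finset.univ_nonempty
          (fun m'' : A => ∑ j, p j * ∑ k, g m'' (φ j k)) ≤
        (K : ℝ) * Finset.univ.inf' Finset.univ_nonempty
          (fun m'' : A => ∑ j, q j * g m'' (ψ j)) := by
  have hK0 : (0 : ℝ) < K := by exact_mod_cast hK
  have key : ∀ f : A → ℝ, (K : ℝ) * Finset.univ.inf' Finset.univ_nonempty f =
      Finset.univ.inf' Finset.univ_nonempty (fun a => (K : ℝ) * f a) := by
    intro f
    apply le_antisymm
    · refine Finset.le_inf' _ _ fun a ha => ?_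
      exact mul_le_mul_of_nonneg_left (Finset.inf'_le f ha) hK0.le
    · obtain ⟨a, ha, h⟩ := Finset.exists_mem_eq_inf' Finset.univ_nonempty f
      rw [h]
      exact Finset.inf'_le (fun a => (K : ℝ) * f a) ha
  refine ⟨?_, ?_⟩
  · rw [key]
    congr 1
    funext a
    simp only [Finset.sum_const, Finset.card_univ, Fintype.card_fin, nsmul_eq_mul]
    rw [Finset.mul_sum]
    exact Finset.sum_congr rfl fun j _ => by ring
  · intro J p φ hp hps
    have h := hmaximin (J * K) (fun l => p (finProdFinEquiv.symm l).1 / K)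
      (fun l => φ (finProdFinEquiv.symm l).1 (finProdFinEquiv.symm l).2)
      (fun l => div_nonneg (hp _) hK0.le)
      (by
        rw [Equiv.sum_comp finProdFinEquiv.symm (fun x : Fin J × Fin K => p x.1 / (K : ℝ)),
          Fintype.sum_prod_type]
        simp only [Finset.sum_const, Finset.card_univ, Fintype.card_fin, nsmul_eq_mul]
        rw [← hps]
        exact Finset.sum_congr rfl fun j _ => by field_simp)
    refine le_trans (le_of_eq ?_) (mul_le_mul_of_nonneg_left h hK0.le)
    rw [key]
    congr 1
    funext a
    rw [Equiv.sum_comp finProdFinEquiv.symm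
      (fun x : Fin J × Fin K => p x.1 / (K : ℝ) * g a (φ x.1 x.2)),
      Fintype.sum_prod_type, Finset.mul_sum]
    refine Finset.sum_congr rfl fun j _ => ?_
    rw [Finset.mul_sum, Finset.mul_sum]
    exact Finset.sum_congr rfl fun k _ => by field_simp
end
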